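/- Let d ≥ 1 and 1 ≤ α < 2, and let f : ℝ^d → ℝ be locally square-integrable and satisfy the tempered growth condition ∫_{ℝ^d} |f(x)| / (1 + |x|^{d+ε}) dx < ∞ for every ε > α. Then the following two conditions are equivalent, and the optimal constants satisfy B² ≈ C up to multiplicative factors depending only on d and α: (i) there exists B < ∞ such that for every z ∈ ℝ^d and R > 0, ∫_{B_R(z)} ∫_{|y| ≤ R} |2f(x) − f(x+y) − f(x−y)|² / |y|^{d+2α} dy dx ≤ B² R^d; (ii) there exists C < ∞ such that for every z ∈ ℝ^d and R > 0, ∫_0^R ∫_{B_R(z)} ( ν₁^f(x,r) / r^{α−1} )² dx dr/r ≤ C R^d. -/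

import Mathlib

open MeasureTheory Metric RealInnerProductSpace

/-- `ν₁^f(x,r)`: the best `L²`-approximation of `f` by affine functions on `B_r(x)`,
normalized by `r`. -/
noncomputable def nu1 (d : ℕ) (f : EuclideanSpace ℝ (Fin d) → ℝ)
    (x : EuclideanSpace ℝ (Fin d)) (r : ℝ) : ℝ :=
  ⨅ p : EuclideanSpace ℝ (Fin d) × ℝ,
    Real.sqrt (⨍ y in ball x r, ((f y - (⟪p.1, y⟫ + p.2)) / r) ^ 2)

theorem affine_stability_Icc {k : ℝ → ℝ} {r ε M : ℝ} (hr : 0 < r)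
    (hk : ∀ s ∈ Set.Icc (-r) r, ∀ t ∈ Set.Icc (-r) r, |k s + k t - 2 * k ((s + t) / 2)| ≤ ε)
    (hM : ∀ t ∈ Set.Icc (-r) r, |k t| ≤ M) (h0 : k 0 = 0) (h1 : k r = 0) :
    ∀ t ∈ Set.Icc (-r) r, |k t| ≤ 2 * ε := by
  have step : ∀ N : ℝ, (∀ t ∈ Set.Icc 0 r, |k t| ≤ N) →
      ∀ t ∈ Set.Icc 0 r, |k t| ≤ N / 2 + ε / 2 := by
    intro N hN t ht
    rcases le_total t (r / 2) with h | h
    · have a := hk 0 ⟨by linarith, hr.le⟩ (2 * t) ⟨by linarith [ht.1], by linarith⟩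
      have b := hN (2 * t) ⟨by linarith [ht.1], by linarith⟩
      rw [h0, show (0 + 2 * t) / 2 = t by ring] at a
      rw [abs_le] at *
      constructor <;> linarith
    · have a := hk r ⟨by linarith, le_rfl⟩ (2 * t - r) ⟨by linarith [ht.1], by linarith [ht.2]⟩
      have b := hN (2 * t - r) ⟨by linarith [ht.1], by linarith [ht.2]⟩
      rw [h1, show (r + (2 * t - r)) / 2 = t by ring] at a
      rw [abs_le] at *
      constructor <;> linarith
  have hne : (0 : ℝ) ∈ Set.Icc 0 r := ⟨le_rfl, hr.le⟩
  have hbdd : BddAbove ((fun t => |k t|) '' Set.Icc 0 r) := by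
    refine ⟨M, ?_⟩
    rintro _ ⟨t, ht, rfl⟩
    exact hM t ⟨by linarith [ht.1], ht.2⟩
  have hle : ∀ t ∈ Set.Icc 0 r, |k t| ≤ sSup ((fun t => |k t|) '' Set.Icc 0 r) :=
    fun t ht => le_csSup hbdd ⟨t, ht, rfl⟩
  have hS : sSup ((fun t => |k t|) '' Set.Icc 0 r)
      ≤ sSup ((fun t => |k t|) '' Set.Icc 0 r) / 2 + ε / 2 := by
    refine csSup_le ⟨|k 0|, 0, hne, rfl⟩ ?_
    rintro _ ⟨t, ht, rfl⟩
    exact step _ hle t ht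
  have hpos : ∀ t ∈ Set.Icc 0 r, |k t| ≤ ε := fun t ht => (hle t ht).trans (by linarith)
  intro t ht
  have hε : 0 ≤ ε := (abs_nonneg _).trans (hpos 0 hne)
  rcases le_total 0 t with h | h
  · linarith [hpos t ⟨h, ht.2⟩]
  · have a := hk t ht (-t) ⟨by linarith, by linarith [ht.1]⟩
    have b := hpos (-t) ⟨by linarith, by linarith [ht.1]⟩
    rw [show (t + -t) / 2 = 0 by ring, h0] at a
    rw [abs_le] at *
    constructor <;> linarith

theorem norm_sum_single_le {d : ℕ} (x : EuclideanSpace ℝ (Fin d)) (S : Finset (Fin d)) :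
    ‖∑ i ∈ S, EuclideanSpace.single i (x i)‖ ≤ ‖x‖ := by
  rw [EuclideanSpace.norm_eq, EuclideanSpace.norm_eq]
  apply Real.sqrt_le_sqrt
  apply Finset.sum_le_sum
  intro j _
  simp only [WithLp.ofLp_sum, Finset.sum_apply, PiLp.single_apply, Finset.sum_ite_eq]
  split_ifs
  · simp
  · simpa using sq_nonneg (x j)

theorem exists_affine_approx_zero {d : ℕ} {h : EuclideanSpace ℝ (Fin d) → ℝ} {r ε M : ℝ}
    (hr : 0 < r)
    (hJ : ∀ a ∈ closedBall (0 : EuclideanSpace ℝ (Fin d)) r, ∀ b ∈ closedBall 0 r,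
      |h a + h b - 2 * h ((1 / 2 : ℝ) • (a + b))| ≤ ε)
    (hM : ∀ a ∈ closedBall 0 r, |h a| ≤ M) :
    ∃ (p : EuclideanSpace ℝ (Fin d)) (c : ℝ),
      ∀ x ∈ closedBall 0 r, |h x - (⟪p, x⟫ + c)| ≤ 4 * d * ε := by
  have hz : (0 : EuclideanSpace ℝ (Fin d)) ∈ closedBall 0 r := by simp [hr.le]
  refine ⟨WithLp.toLp 2 fun i => (h (EuclideanSpace.single i r) - h 0) / r, h 0, ?_⟩
  have line : ∀ i, ∀ t ∈ Set.Icc (-r) r,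
      |h (EuclideanSpace.single i t) - h 0 - t * ((h (EuclideanSpace.single i r) - h 0) / r)|
        ≤ 2 * ε := by
    intro i
    have mem : ∀ t ∈ Set.Icc (-r) r,
        (EuclideanSpace.single i t : EuclideanSpace ℝ (Fin d)) ∈ closedBall 0 r := by
      intro t ht
      simpa [abs_le] using ht
    refine affine_stability_Icc
      (k := fun t => h (EuclideanSpace.single i t) - h 0 -
        t * ((h (EuclideanSpace.single i r) - h 0) / r))
      (M := M + |h 0| + r * |(h (EuclideanSpace.single i r) - h 0) / r|) hr ?_ ?_ ?_ ?_
    · intro s hs t ht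
      have := hJ _ (mem s hs) _ (mem t ht)
      have e : (1 / 2 : ℝ) • ((EuclideanSpace.single i s : EuclideanSpace ℝ (Fin d))
          + EuclideanSpace.single i t) = EuclideanSpace.single i ((s + t) / 2) := by
        ext j
        by_cases hj : j = i <;> simp [hj]
        ring
      rw [e] at this
      convert this using 2
      ring
    · intro t ht
      have h1 := hM _ (mem t ht)
      have h2 : |t * ((h (EuclideanSpace.single i r) - h 0) / r)|
          ≤ r * |(h (EuclideanSpace.single i r) - h 0) / r| := by
        rw [abs_mul]
        gcongr
        exact abs_le.2 ht
      have h3 := abs_sub (h (EuclideanSpace.single i t) - h 0)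
        (t * ((h (EuclideanSpace.single i r) - h 0) / r))
      have h4 := abs_sub (h (EuclideanSpace.single i t)) (h 0)
      linarith
    · have : (EuclideanSpace.single i (0 : ℝ) : EuclideanSpace ℝ (Fin d)) = 0 := by
        ext j; simp
      simp [this]
    · field_simp
      ring
  have hadd : ∀ a ∈ closedBall (0 : EuclideanSpace ℝ (Fin d)) r, ∀ b ∈ closedBall 0 r,
      a + b ∈ closedBall 0 r → |(h (a + b) - h 0) - (h a - h 0) - (h b - h 0)| ≤ 2 * ε := by
    intro a ha b hb hab
    have h1 := hJ a ha b hb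
    have h2 := hJ (a + b) hab 0 hz
    rw [add_zero] at h2
    rw [abs_le] at *
    constructor <;> linarith
  intro x hx
  have hxr : ‖x‖ ≤ r := by simpa using hx
  have hcoord : ∀ i, x i ∈ Set.Icc (-r) r := fun i =>
    abs_le.1 ((PiLp.norm_apply_le x i).trans hxr)
  have hsum : ∀ S : Finset (Fin d),
      |(h (∑ i ∈ S, EuclideanSpace.single i (x i)) - h 0) -
        ∑ i ∈ S, x i * ((h (EuclideanSpace.single i r) - h 0) / r)| ≤ 4 * S.card * ε := by
    intro S
    induction S using Finset.induction_on with
    | empty => simp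
    | insert i S hi ih =>
      have m1 : ∀ T : Finset (Fin d),
          ∑ i ∈ T, EuclideanSpace.single i (x i) ∈ closedBall (0 : EuclideanSpace ℝ (Fin d)) r :=
        fun T => by simpa using (norm_sum_single_le x T).trans hxr
      have m2 : EuclideanSpace.single i (x i) ∈ closedBall (0 : EuclideanSpace ℝ (Fin d)) r := by
        simpa using m1 {i}
      have m3 := m1 (insert i S)
      rw [Finset.sum_insert hi] at m3
      have h1 := hadd _ m2 _ (m1 S) m3
      have h2 := line i _ (hcoord i)
      rw [Finset.sum_insert hi, Finset.sum_insert hi, Finset.card_insert_of_notMem hi]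
      push_cast
      rw [abs_le] at *
      constructor <;> linarith
  have := hsum Finset.univ
  have e : ∑ i, EuclideanSpace.single i (x i) = x := by
    ext j
    simp
  rw [e, Finset.card_univ, Fintype.card_fin] at this
  convert this using 2
  rw [PiLp.inner_apply]
  simp
  ring

theorem exists_affine_approx {d : ℕ} {h : EuclideanSpace ℝ (Fin d) → ℝ} {r ε M : ℝ}
    {x₀ : EuclideanSpace ℝ (Fin d)} (hr : 0 < r)
    (hJ : ∀ a ∈ closedBall x₀ r, ∀ b ∈ closedBall x₀ r,
      |h a + h b - 2 * h ((1 / 2 : ℝ) • (a + b))| ≤ ε)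
    (hM : ∀ a ∈ closedBall x₀ r, |h a| ≤ M) :
    ∃ (p : EuclideanSpace ℝ (Fin d)) (c : ℝ),
      ∀ x ∈ closedBall x₀ r, |h x - (⟪p, x⟫ + c)| ≤ 4 * d * ε := by
  have mem : ∀ a ∈ closedBall (0 : EuclideanSpace ℝ (Fin d)) r, x₀ + a ∈ closedBall x₀ r := by
    intro a ha
    simpa using ha
  obtain ⟨p, c, hpc⟩ := exists_affine_approx_zero (h := fun a => h (x₀ + a)) (ε := ε) (M := M) hr
    (fun a ha b hb => by
      have := hJ _ (mem a ha) _ (mem b hb)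
      convert this using 5
      module)
    (fun a ha => hM _ (mem a ha))
  refine ⟨p, c - ⟪p, x₀⟫, fun x hx => ?_⟩
  have := hpc (x - x₀) (by simpa [dist_eq_norm] using hx)
  simp only [add_sub_cancel, inner_sub_right] at this
  convert this using 2
  ring

theorem sq_lintegral_le {X : Type*} [MeasurableSpace X] (μ : Measure X) {h : X → ENNReal}
    (hh : AEMeasurable h μ) : (∫⁻ x, h x ∂μ) ^ 2 ≤ μ Set.univ * ∫⁻ x, h x ^ 2 ∂μ := by
  have := ENNReal.lintegral_mul_le_Lp_mul_Lq μ Real.HolderConjugate.two_two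
    (aemeasurable_const (b := 1)) hh
  simp only [Pi.mul_apply, one_mul, ENNReal.one_rpow, lintegral_const] at this
  calc (∫⁻ x, h x ∂μ) ^ 2
      ≤ (μ Set.univ ^ (1 / 2 : ℝ) * (∫⁻ x, h x ^ (2 : ℝ) ∂μ) ^ (1 / 2 : ℝ)) ^ 2 := by
        gcongr
    _ = μ Set.univ * ∫⁻ x, h x ^ 2 ∂μ := by
        rw [mul_pow, ← ENNReal.rpow_natCast, ← ENNReal.rpow_natCast, ← ENNReal.rpow_mul,
          ← ENNReal.rpow_mul]
        norm_num

theorem ofReal_sq_integral_le {X : Type*} [MeasurableSpace X] (μ : Measure X) {h : X → ℝ}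
    (hh : AEMeasurable h μ) :
    ENNReal.ofReal ((∫ x, h x ∂μ) ^ 2) ≤ μ Set.univ * ∫⁻ x, ENNReal.ofReal (h x ^ 2) ∂μ := by
  have e : ∀ t : ℝ, ENNReal.ofReal (t ^ 2) = ‖t‖ₑ ^ 2 := fun t => by
    rw [← sq_abs, ENNReal.ofReal_pow (abs_nonneg t), ← Real.norm_eq_abs, ofReal_norm]
  simp only [e]
  calc ‖∫ x, h x ∂μ‖ₑ ^ 2 ≤ (∫⁻ x, ‖h x‖ₑ ∂μ) ^ 2 := by
        gcongr
        exact enorm_integral_le_lintegral_enorm _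
    _ ≤ _ := sq_lintegral_le μ hh.enorm

/-- The square of the second difference of `f` at `u` with step `y`. -/
noncomputable def secondDiffSq {E : Type*} [AddCommGroup E] (f : E → ℝ) (u y : E) : ENNReal :=
  ENNReal.ofReal (|2 * f u - f (u + y) - f (u - y)| ^ 2)

theorem measurable_secondDiffSq {E : Type*} [NormedAddCommGroup E] [MeasurableSpace E]
    [BorelSpace E] [SecondCountableTopology E] {f : E → ℝ} (hf : Measurable f) :
    Measurable fun z : E × E => secondDiffSq f z.1 z.2 := by
  unfold secondDiffSq
  fun_prop

theorem ball_subset_ball_two_mul {E : Type*} [PseudoMetricSpace E] {x a : E} {r : ℝ}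
    (ha : a ∈ closedBall x r) : ball a r ⊆ ball x (2 * r) := fun p hp => by
  rw [mem_ball] at *
  rw [mem_closedBall] at ha
  linarith [dist_triangle p a x]

theorem integrableOn_ball_add_left {E : Type*} [NormedAddCommGroup E] [MeasurableSpace E]
    [BorelSpace E] (μ : Measure E) [μ.IsAddLeftInvariant] {f : E → ℝ}
    (hfi : ∀ x s, IntegrableOn f (ball x s) μ) (a : E) (r : ℝ) :
    IntegrableOn (fun s => f (a + s)) (ball 0 r) μ := by
  have h := (measurePreserving_add_left μ a).integrableOn_comp_preimage
    (measurableEmbedding_addLeft a) (f := f) (s := ball a r)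
  have e : (fun s => a + s) ⁻¹' ball a r = ball 0 r := by ext; simp
  rw [e] at h
  exact h.2 (hfi a r)

theorem setLIntegral_ball_add_left {E : Type*} [NormedAddCommGroup E] [MeasurableSpace E]
    [BorelSpace E] (μ : Measure E) [μ.IsAddLeftInvariant] (Φ : E → ENNReal) (a : E) (r : ℝ) :
    ∫⁻ s in ball 0 r, Φ (a + s) ∂μ = ∫⁻ p in ball a r, Φ p ∂μ := by
  rw [← lintegral_indicator measurableSet_ball, ← lintegral_indicator measurableSet_ball,
    ← lintegral_add_left_eq_self ((ball a r).indicator Φ) a]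
  congr 1 with s
  by_cases hs : s ∈ ball (0 : E) r
  · rw [Set.indicator_of_mem hs, Set.indicator_of_mem (by simpa using hs)]
  · rw [Set.indicator_of_notMem hs, Set.indicator_of_notMem (by simpa using hs)]

section Haar

variable {E : Type*} [NormedAddCommGroup E] [NormedSpace ℝ E] [MeasurableSpace E] [BorelSpace E]
  [FiniteDimensional ℝ E] [SecondCountableTopology E] (μ : Measure E) [μ.IsAddHaarMeasure]

theorem lintegral_eq_lintegral_sub_two_smul {Φ : E → ENNReal} (hΦ : Measurable Φ) (p : E) :
    ∫⁻ q, Φ q ∂μ = 2 ^ Module.finrank ℝ E * ∫⁻ y, Φ (p - (2 : ℝ) • y) ∂μ := by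
  have h1 : ∫⁻ y, Φ (p - (2 : ℝ) • y) ∂μ = ∫⁻ z, Φ (p - z) ∂(μ.map ((2 : ℝ) • ·)) := by
    rw [lintegral_map (by fun_prop) (by fun_prop)]
  rw [h1, Measure.map_addHaar_smul μ two_ne_zero, lintegral_smul_measure,
    lintegral_sub_left_eq_self, smul_eq_mul, ← mul_assoc]
  have : (2 : ENNReal) ^ Module.finrank ℝ E
      * ENNReal.ofReal |((2 : ℝ) ^ Module.finrank ℝ E)⁻¹| = 1 := by
    rw [abs_of_pos (by positivity), ENNReal.ofReal_inv_of_pos (by positivity),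
      ENNReal.ofReal_pow (by norm_num), ENNReal.ofReal_ofNat]
    exact ENNReal.mul_inv_cancel (by simp) (by simp)
  rw [this, one_mul]

theorem lintegral_jensenDiff_le {f : E → ℝ} (hf : Measurable f) (x : E) (s : ℝ) :
    ∫⁻ p in ball x s, ∫⁻ q in ball x s,
        ENNReal.ofReal ((f p + f q - 2 * f ((1 / 2 : ℝ) • (p + q))) ^ 2) ∂μ ∂μ
      ≤ 2 ^ Module.finrank ℝ E *
        ∫⁻ u in ball x s, ∫⁻ y in closedBall 0 s, secondDiffSq f u y ∂μ ∂μ := by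
  set H : E → E → ENNReal := fun p q =>
    (ball x s ×ˢ ball x s).indicator (fun z : E × E =>
      ENNReal.ofReal ((f z.1 + f z.2 - 2 * f ((1 / 2 : ℝ) • (z.1 + z.2))) ^ 2)) (p, q) with hH
  have hHm : Measurable fun z : E × E => H z.1 z.2 := by
    refine Measurable.indicator ?_ (measurableSet_ball.prod measurableSet_ball)
    fun_prop
  have e1 : ∫⁻ p in ball x s, ∫⁻ q in ball x s,
        ENNReal.ofReal ((f p + f q - 2 * f ((1 / 2 : ℝ) • (p + q))) ^ 2) ∂μ ∂μ
      = ∫⁻ p, ∫⁻ q, H p q ∂μ ∂μ := by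
    rw [← lintegral_indicator measurableSet_ball]
    congr 1 with p
    by_cases hp : p ∈ ball x s
    · rw [Set.indicator_of_mem hp, ← lintegral_indicator measurableSet_ball]
      congr 1 with q
      by_cases hq : q ∈ ball x s
      · simp only [hH]
        rw [Set.indicator_of_mem hq, Set.indicator_of_mem (Set.mk_mem_prod hp hq)]
      · simp only [hH]
        rw [Set.indicator_of_notMem hq, Set.indicator_of_notMem fun h => hq h.2]
    · rw [Set.indicator_of_notMem hp]
      have : ∀ q, H p q = 0 := fun q => Set.indicator_of_notMem (fun h => hp h.1) _
      simp [this]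
  have e2 : ∀ p, ∫⁻ q, H p q ∂μ
      = 2 ^ Module.finrank ℝ E * ∫⁻ y, H p (p - (2 : ℝ) • y) ∂μ := fun p =>
    lintegral_eq_lintegral_sub_two_smul μ (hHm.comp measurable_prodMk_left) p
  have hm2 : Measurable fun z : E × E => H z.1 (z.1 - (2 : ℝ) • z.2) :=
    hHm.comp (by fun_prop : Measurable fun z : E × E => (z.1, z.1 - (2 : ℝ) • z.2))
  rw [e1]
  simp only [e2]
  rw [lintegral_const_mul' _ _ (by simp)]
  refine mul_le_mul_right ?_ _
  rw [lintegral_lintegral_swap hm2.aemeasurable]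
  have e3 : ∀ y, ∫⁻ p, H p (p - (2 : ℝ) • y) ∂μ = ∫⁻ u, H (u + y) (u - y) ∂μ := fun y => by
    rw [← lintegral_add_right_eq_self _ y]
    congr 1 with u
    congr 1
    module
  simp only [e3]
  have e4 : ∀ u y, H (u + y) (u - y) ≤ (ball x s).indicator
      (fun u => (closedBall 0 s).indicator (fun y => secondDiffSq f u y) y) u := by
    intro u y
    by_cases h : (u + y, u - y) ∈ ball x s ×ˢ ball x s
    · have h1 : ‖u + y - x‖ < s := by simpa [dist_eq_norm] using h.1
      have h2 : ‖u - y - x‖ < s := by simpa [dist_eq_norm] using h.2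
      have hu : u ∈ ball x s := by
        rw [mem_ball, dist_eq_norm, show u - x = (1 / 2 : ℝ) • ((u + y - x) + (u - y - x)) by module,
          norm_smul]
        have := norm_add_le (u + y - x) (u - y - x)
        rw [Real.norm_of_nonneg (by norm_num)]
        linarith
      have hy : y ∈ closedBall (0 : E) s := by
        rw [mem_closedBall_zero_iff, show y = (1 / 2 : ℝ) • ((u + y - x) - (u - y - x)) by module,
          norm_smul]
        have := norm_sub_le (u + y - x) (u - y - x)
        rw [Real.norm_of_nonneg (by norm_num)]
        linarith
      rw [Set.indicator_of_mem hu, Set.indicator_of_mem hy]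
      simp only [hH]
      rw [Set.indicator_of_mem h, secondDiffSq, sq_abs]
      apply le_of_eq
      rw [show (1 / 2 : ℝ) • (u + y + (u - y)) = u by module]
      congr 1
      ring
    · simp only [hH]
      rw [Set.indicator_of_notMem h]
      exact zero_le
  have hm3 : Measurable fun z : E × E => H (z.2 + z.1) (z.2 - z.1) :=
    hHm.comp (by fun_prop : Measurable fun z : E × E => (z.2 + z.1, z.2 - z.1))
  rw [lintegral_lintegral_swap hm3.aemeasurable, ← lintegral_indicator measurableSet_ball]
  refine lintegral_mono fun u => (lintegral_mono (e4 u)).trans ?_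
  by_cases hu : u ∈ ball x s
  · simp only [Set.indicator_of_mem hu]
    rw [lintegral_indicator measurableSet_closedBall]
  · simp [Set.indicator_of_notMem hu]

theorem sq_jensen_integral_le {f : E → ℝ} (hf : Measurable f)
    (hfi : ∀ x s, IntegrableOn f (ball x s) μ) {x a b : E} {r : ℝ}
    (ha : a ∈ closedBall x r) (hb : b ∈ closedBall x r)
    (hD : ∫⁻ u in ball x (2 * r), ∫⁻ y in closedBall 0 (2 * r), secondDiffSq f u y ∂μ ∂μ ≠ ⊤) :
    (μ.real (ball 0 r) * (∫ s in ball 0 r, f (a + s) ∂μ + ∫ s in ball 0 r, f (b + s) ∂μ)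
      - 2 * ∫ z, f ((1 / 2 : ℝ) • (a + b) + (1 / 2 : ℝ) • (z.1 + z.2))
          ∂(μ.restrict (ball 0 r)).prod (μ.restrict (ball 0 r))) ^ 2
    ≤ μ.real (ball 0 r) ^ 2 * (2 ^ Module.finrank ℝ E *
        (∫⁻ u in ball x (2 * r), ∫⁻ y in closedBall 0 (2 * r),
          secondDiffSq f u y ∂μ ∂μ).toReal) := by
  set D := ∫⁻ u in ball x (2 * r), ∫⁻ y in closedBall 0 (2 * r), secondDiffSq f u y ∂μ ∂μ
  set ν := μ.restrict (ball (0 : E) r) with hν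
  have : IsFiniteMeasure ν := ⟨by rw [hν, Measure.restrict_apply_univ]; exact measure_ball_lt_top⟩
  have hνr : ν.real Set.univ = μ.real (ball 0 r) := by simp [hν, Measure.real]
  set H : E × E → ℝ := fun z => f (a + z.1) + f (b + z.2)
    - 2 * f ((1 / 2 : ℝ) • (a + b) + (1 / 2 : ℝ) • (z.1 + z.2)) with hH
  have hHm : Measurable H := by fun_prop
  have hle : ∫⁻ z, ENNReal.ofReal (H z ^ 2) ∂(ν.prod ν) ≤ 2 ^ Module.finrank ℝ E * D := by
    refine le_trans ?_ (lintegral_jensenDiff_le μ hf x (2 * r))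
    rw [lintegral_prod _ (by fun_prop)]
    have e : ∀ s t, H (s, t) = f (a + s) + f (b + t)
        - 2 * f ((1 / 2 : ℝ) • ((a + s) + (b + t))) := fun s t => by
      simp only [hH]
      congr 3
      module
    have hK : Measurable fun z : E × E =>
        ENNReal.ofReal ((f z.1 + f z.2 - 2 * f ((1 / 2 : ℝ) • (z.1 + z.2))) ^ 2) := by fun_prop
    simp only [e]
    have e2 : ∀ s, ∫⁻ t, ENNReal.ofReal
        ((f (a + s) + f (b + t) - 2 * f ((1 / 2 : ℝ) • ((a + s) + (b + t)))) ^ 2) ∂ν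
        = ∫⁻ q in ball b r, ENNReal.ofReal
          ((f (a + s) + f q - 2 * f ((1 / 2 : ℝ) • ((a + s) + q))) ^ 2) ∂μ := fun s =>
      setLIntegral_ball_add_left μ (fun q => ENNReal.ofReal
          ((f (a + s) + f q - 2 * f ((1 / 2 : ℝ) • ((a + s) + q))) ^ 2)) b r
    simp only [e2]
    have e3 := setLIntegral_ball_add_left μ (fun p => ∫⁻ q in ball b r, ENNReal.ofReal
          ((f p + f q - 2 * f ((1 / 2 : ℝ) • (p + q))) ^ 2) ∂μ)
      a r
    rw [e3]
    refine (lintegral_mono_set (ball_subset_ball_two_mul ha)).trans ?_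
    exact lintegral_mono fun p => lintegral_mono_set (ball_subset_ball_two_mul hb)
  have hfin : ∫⁻ z, ENNReal.ofReal (H z ^ 2) ∂(ν.prod ν) ≠ ⊤ :=
    ne_top_of_le_ne_top (ENNReal.mul_ne_top (by simp) hD) hle
  have hHi : Integrable H (ν.prod ν) := by
    refine MemLp.integrable one_le_two ((memLp_two_iff_integrable_sq hHm.aestronglyMeasurable).2 ?_)
    exact (lintegral_ofReal_ne_top_iff_integrable (by fun_prop)
      (Filter.Eventually.of_forall fun z => sq_nonneg _)).1 hfin
  have h1 : Integrable (fun z : E × E => f (a + z.1)) (ν.prod ν) :=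
    (integrableOn_ball_add_left μ hfi a r).integrable.comp_fst ν
  have h2 : Integrable (fun z : E × E => f (b + z.2)) (ν.prod ν) :=
    (integrableOn_ball_add_left μ hfi b r).integrable.comp_snd ν
  have h3 : Integrable (fun z : E × E =>
      2 * f ((1 / 2 : ℝ) • (a + b) + (1 / 2 : ℝ) • (z.1 + z.2))) (ν.prod ν) := by
    refine ((h1.add h2).sub hHi).congr (Filter.Eventually.of_forall fun z => ?_)
    simp [hH]
  have key : ∫ z, H z ∂(ν.prod ν) = μ.real (ball 0 r) *
      (∫ s in ball 0 r, f (a + s) ∂μ + ∫ s in ball 0 r, f (b + s) ∂μ)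
      - 2 * ∫ z, f ((1 / 2 : ℝ) • (a + b) + (1 / 2 : ℝ) • (z.1 + z.2)) ∂(ν.prod ν) := by
    have h12 : Integrable (fun z : E × E => f (a + z.1) + f (b + z.2)) (ν.prod ν) := h1.add h2
    simp only [hH]
    rw [integral_sub h12 h3, integral_add h1 h2, integral_const_mul,
      integral_fun_fst (fun s => f (a + s)), integral_fun_snd (fun s => f (b + s)), hνr]
    simp only [smul_eq_mul]
    ring
  rw [← key]
  have := (ofReal_sq_integral_le (ν.prod ν) hHm.aemeasurable).trans (mul_le_mul_right hle _)
  have h4 := ENNReal.toReal_mono (ENNReal.mul_ne_top (measure_ne_top _ _)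
    (ENNReal.mul_ne_top (by simp) hD)) this
  rw [ENNReal.toReal_ofReal (sq_nonneg _)] at h4
  refine h4.trans (le_of_eq ?_)
  rw [← Set.univ_prod_univ, Measure.prod_prod]
  simp only [ENNReal.toReal_mul, ENNReal.toReal_pow, ← measureReal_def, hνr]
  simp only [ENNReal.toReal_ofNat]
  ring

theorem abs_jensen_ball_integral_le {f : E → ℝ} (hf : Measurable f)
    (hfi : ∀ x s, IntegrableOn f (ball x s) μ) {x a b : E} {r : ℝ} (hr : 0 < r)
    (ha : a ∈ closedBall x r) (hb : b ∈ closedBall x r)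
    (hD : ∫⁻ u in ball x (2 * r), ∫⁻ y in closedBall 0 (2 * r), secondDiffSq f u y ∂μ ∂μ ≠ ⊤) :
    |∫ s in ball 0 r, f (a + s) ∂μ + ∫ s in ball 0 r, f (b + s) ∂μ
      - 2 * ∫ s in ball 0 r, f ((1 / 2 : ℝ) • (a + b) + s) ∂μ|
    ≤ 2 * √(2 ^ Module.finrank ℝ E *
        (∫⁻ u in ball x (2 * r), ∫⁻ y in closedBall 0 (2 * r),
          secondDiffSq f u y ∂μ ∂μ).toReal) := by
  have hm : (1 / 2 : ℝ) • (a + b) ∈ closedBall x r := by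
    rw [smul_add]
    exact convex_closedBall x r ha hb (by norm_num) (by norm_num) (by norm_num)
  have hv : 0 < μ.real (ball (0 : E) r) :=
    ENNReal.toReal_pos (measure_ball_pos μ _ hr).ne' measure_ball_lt_top.ne
  have h1 := sq_jensen_integral_le μ hf hfi ha hb hD
  have h2 := sq_jensen_integral_le μ hf hfi hm hm hD
  rw [show (1 / 2 : ℝ) • ((1 / 2 : ℝ) • (a + b) + (1 / 2 : ℝ) • (a + b))
    = (1 / 2 : ℝ) • (a + b) by module] at h2
  set D := ∫⁻ u in ball x (2 * r), ∫⁻ y in closedBall 0 (2 * r), secondDiffSq f u y ∂μ ∂μ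
  have h3 := Real.abs_le_sqrt h1
  have h4 := Real.abs_le_sqrt h2
  rw [Real.sqrt_mul (sq_nonneg _), Real.sqrt_sq hv.le] at h3 h4
  refine le_of_mul_le_mul_left ?_ hv
  rw [← abs_of_pos hv, ← abs_mul, abs_of_pos hv]
  rw [abs_le] at *
  constructor <;> linarith

theorem lintegral_sq_sub_ball_integral_le {f : E → ℝ} (hf : Measurable f)
    (hfi : ∀ x s, IntegrableOn f (ball x s) μ) (x : E) {r : ℝ} (hr : 0 < r) :
    ∫⁻ y in ball x r, ENNReal.ofReal
      ((μ.real (ball 0 r) * f y - ∫ s in ball 0 r, f (y + s) ∂μ) ^ 2) ∂μ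
    ≤ μ (ball 0 r) *
      ∫⁻ u in ball x (2 * r), ∫⁻ y in closedBall 0 (2 * r), secondDiffSq f u y ∂μ ∂μ := by
  have neg : ∀ y, IntegrableOn (fun s => f (y - s)) (ball 0 r) μ ∧
      ∫ s in ball 0 r, f (y - s) ∂μ = ∫ s in ball 0 r, f (y + s) ∂μ := fun y => by
    have mp := Measure.measurePreserving_neg μ
    have e : (Neg.neg : E → E) ⁻¹' ball 0 r = ball 0 r := by ext; simp
    constructor
    · have := mp.integrableOn_comp_preimage (MeasurableEquiv.neg E).measurableEmbedding
        (f := fun s => f (y + s)) (s := ball 0 r)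
      rw [e] at this
      simpa [Function.comp_def, sub_eq_add_neg] using
        this.2 (integrableOn_ball_add_left μ hfi y r)
    · have := mp.setIntegral_preimage_emb (MeasurableEquiv.neg E).measurableEmbedding
        (fun s => f (y + s)) (ball 0 r)
      rw [e] at this
      simpa [sub_eq_add_neg] using this
  have hpt : ∀ y, ENNReal.ofReal
      ((μ.real (ball 0 r) * f y - ∫ s in ball 0 r, f (y + s) ∂μ) ^ 2)
      ≤ μ (ball 0 r) * ∫⁻ s in closedBall 0 (2 * r), secondDiffSq f y s ∂μ := fun y => by
    have hi := integrableOn_ball_add_left μ hfi y r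
    have hc : IntegrableOn (fun _ : E => 2 * f y) (ball 0 r) μ :=
      integrableOn_const measure_ball_lt_top.ne
    have e : ∫ s in ball 0 r, (2 * f y - f (y + s) - f (y - s)) ∂μ
        = 2 * (μ.real (ball 0 r) * f y - ∫ s in ball 0 r, f (y + s) ∂μ) := by
      have hci : IntegrableOn (fun s => 2 * f y - f (y + s)) (ball 0 r) μ := hc.sub hi
      rw [integral_sub hci (neg y).1, integral_sub hc hi, (neg y).2, setIntegral_const,
        smul_eq_mul]
      ring
    have h := ofReal_sq_integral_le (μ.restrict (ball 0 r))
      (h := fun s => 2 * f y - f (y + s) - f (y - s)) (by fun_prop)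
    rw [e, Measure.restrict_apply_univ] at h
    have h4 : ∀ t : ℝ, t ^ 2 ≤ (2 * t) ^ 2 := fun t => by nlinarith [sq_nonneg t]
    calc _ ≤ _ := ENNReal.ofReal_le_ofReal (h4 _)
      _ ≤ _ := h
      _ ≤ _ := by
        refine mul_le_mul_right ?_ _
        simp only [secondDiffSq, sq_abs]
        exact lintegral_mono_set ((ball_subset_ball (by linarith)).trans ball_subset_closedBall)
  calc _ ≤ ∫⁻ y in ball x r, μ (ball 0 r) *
        ∫⁻ s in closedBall 0 (2 * r), secondDiffSq f y s ∂μ ∂μ := lintegral_mono hpt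
    _ = μ (ball 0 r) * ∫⁻ y in ball x r,
        ∫⁻ s in closedBall 0 (2 * r), secondDiffSq f y s ∂μ ∂μ :=
      lintegral_const_mul' _ _ measure_ball_lt_top.ne
    _ ≤ _ := by
      refine mul_le_mul_right ?_ _
      exact lintegral_mono_set (ball_subset_ball (by linarith))

end Haar

theorem integrableOn_ball_of_sq {d : ℕ} {f : EuclideanSpace ℝ (Fin d) → ℝ} (hf : Measurable f)
    (hf2 : LocallyIntegrable (fun x => f x ^ 2)) (x : EuclideanSpace ℝ (Fin d)) (s : ℝ) :
    IntegrableOn f (ball x s) := by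
  have h : IntegrableOn (fun x => f x ^ 2) (ball x s) :=
    (hf2.integrableOn_isCompact (isCompact_closedBall x s)).mono_set ball_subset_closedBall
  have h1 : IntegrableOn (fun _ => (1 : ℝ)) (ball x s) := integrableOn_const measure_ball_lt_top.ne
  refine (h.add h1).mono' hf.aestronglyMeasurable (Filter.Eventually.of_forall fun y => ?_)
  rw [Real.norm_eq_abs, Pi.add_apply, ← sq_abs]
  nlinarith [sq_nonneg (|f y| - 1), abs_nonneg (f y)]

theorem exists_affine_lintegral_sq_le {d : ℕ} {f : EuclideanSpace ℝ (Fin d) → ℝ}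
    (hf : Measurable f) (hfi : ∀ x s, IntegrableOn f (ball x s))
    (x : EuclideanSpace ℝ (Fin d)) {r : ℝ} (hr : 0 < r) :
    ∃ (p : EuclideanSpace ℝ (Fin d)) (c : ℝ),
      volume (ball (0 : EuclideanSpace ℝ (Fin d)) r) *
        ∫⁻ y in ball x r, ENNReal.ofReal ((f y - (⟪p, y⟫ + c)) ^ 2)
      ≤ ENNReal.ofReal (2 + 128 * d ^ 2 * 2 ^ d) *
        ∫⁻ u in ball x (2 * r), ∫⁻ y in closedBall 0 (2 * r), secondDiffSq f u y := by
  set D := ∫⁻ u in ball x (2 * r), ∫⁻ y in closedBall 0 (2 * r), secondDiffSq f u y with hDdef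
  have hCpos : (0 : ℝ) < 2 + 128 * d ^ 2 * 2 ^ d := by positivity
  by_cases hD : D = ⊤
  · refine ⟨0, 0, ?_⟩
    rw [hD, ENNReal.mul_top (by simpa using hCpos)]
    exact le_top
  set v := volume.real (ball (0 : EuclideanSpace ℝ (Fin d)) r) with hv
  have hvpos : 0 < v := ENNReal.toReal_pos (measure_ball_pos _ _ hr).ne' measure_ball_lt_top.ne
  have hV : volume (ball (0 : EuclideanSpace ℝ (Fin d)) r) = ENNReal.ofReal v :=
    (ENNReal.ofReal_toReal measure_ball_lt_top.ne).symm
  set g : EuclideanSpace ℝ (Fin d) → ℝ := fun a => ∫ s in ball 0 r, f (a + s) with hg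
  obtain ⟨p, c, hpc⟩ := exists_affine_approx (h := g) (x₀ := x) (r := r)
    (M := ∫ y in ball x (2 * r), |f y|) hr
    (fun a ha b hb => abs_jensen_ball_integral_le volume hf hfi hr ha hb hD) (by
      intro a ha
      have mp := measurePreserving_add_left (volume : Measure (EuclideanSpace ℝ (Fin d))) a
      have h := mp.setIntegral_preimage_emb (measurableEmbedding_addLeft a) f (ball a r)
      have e : (fun s => a + s) ⁻¹' ball a r = ball 0 r := by ext; simp
      rw [e] at h
      simp only [hg]
      rw [h]
      refine (abs_integral_le_integral_abs).trans ?_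
      exact setIntegral_mono_set (hfi x (2 * r)).abs
        (Filter.Eventually.of_forall fun _ => abs_nonneg _)
        (ball_subset_ball_two_mul ha).eventuallyLE)
  rw [finrank_euclideanSpace_fin, ← hDdef] at hpc
  set K := D.toReal
  have hK : ENNReal.ofReal K = D := ENNReal.ofReal_toReal hD
  have hK0 : 0 ≤ K := ENNReal.toReal_nonneg
  refine ⟨v⁻¹ • p, v⁻¹ * c, ?_⟩
  have hpt : ∀ y ∈ ball x r, ENNReal.ofReal (v ^ 2) *
      ENNReal.ofReal ((f y - (⟪v⁻¹ • p, y⟫ + v⁻¹ * c)) ^ 2)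
      ≤ ENNReal.ofReal 2 * ENNReal.ofReal ((v * f y - g y) ^ 2) + ENNReal.ofReal (128 * d ^ 2 * 2 ^ d * K) := by
    intro y hy
    have h1 := hpc y (ball_subset_closedBall hy)
    have h2 : (g y - (⟪p, y⟫ + c)) ^ 2 ≤ 64 * d ^ 2 * 2 ^ d * K := by
      rw [← sq_abs]
      calc _ ≤ (4 * d * (2 * √(2 ^ d * K))) ^ 2 := by gcongr
        _ = 64 * d ^ 2 * √(2 ^ d * K) ^ 2 := by ring
        _ = _ := by rw [Real.sq_sqrt (by positivity)]; ring
    rw [← ENNReal.ofReal_mul (by positivity),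
      ← ENNReal.ofReal_mul (by positivity), ← ENNReal.ofReal_add (by positivity) (by positivity)]
    apply ENNReal.ofReal_le_ofReal
    have e : v ^ 2 * (f y - (⟪v⁻¹ • p, y⟫ + v⁻¹ * c)) ^ 2
        = ((v * f y - g y) + (g y - (⟪p, y⟫ + c))) ^ 2 := by
      rw [real_inner_smul_left]
      field_simp
      ring
    rw [e]
    nlinarith [sq_nonneg ((v * f y - g y) - (g y - (⟪p, y⟫ + c)))]
  have hI := lintegral_sq_sub_ball_integral_le volume hf hfi x hr
  rw [← hv, ← hDdef] at hI
  have hmeas : Measurable fun y => ENNReal.ofReal 2 * ENNReal.ofReal ((v * f y - g y) ^ 2) := by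
    have : Measurable g :=
      (StronglyMeasurable.integral_prod_right (f := fun a s => f (a + s))
        (by fun_prop : Measurable fun z : EuclideanSpace ℝ (Fin d) × EuclideanSpace ℝ (Fin d) =>
          f (z.1 + z.2)).stronglyMeasurable).measurable
    fun_prop
  have key : ENNReal.ofReal (v ^ 2) *
      ∫⁻ y in ball x r, ENNReal.ofReal ((f y - (⟪v⁻¹ • p, y⟫ + v⁻¹ * c)) ^ 2)
      ≤ ENNReal.ofReal v * (ENNReal.ofReal (2 + 128 * d ^ 2 * 2 ^ d) * D) := by
    rw [← lintegral_const_mul' _ _ ENNReal.ofReal_ne_top]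
    refine (setLIntegral_mono' measurableSet_ball hpt).trans ?_
    rw [lintegral_add_left hmeas, lintegral_const_mul' _ _ (by simp), setLIntegral_const,
      Measure.addHaar_ball_center, hV]
    calc _ ≤ ENNReal.ofReal 2 * (ENNReal.ofReal v * D)
          + ENNReal.ofReal (128 * d ^ 2 * 2 ^ d * K) * ENNReal.ofReal v := by
          rw [← hV]; gcongr
      _ = _ := by
        rw [ENNReal.ofReal_mul (by positivity), hK, ENNReal.ofReal_add (by norm_num)
          (by positivity)]
        ring
  rw [sq, ENNReal.ofReal_mul hvpos.le, mul_assoc,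
    ENNReal.mul_le_mul_iff_right (by simpa using hvpos) (by simp)] at key
  rw [hV]
  exact key

theorem setAverage_ball_div_sq {d : ℕ} (h : EuclideanSpace ℝ (Fin d) → ℝ)
    (x : EuclideanSpace ℝ (Fin d)) (r : ℝ) :
    ⨍ y in ball x r, (h y / r) ^ 2 = (volume.real (ball (0 : EuclideanSpace ℝ (Fin d)) r))⁻¹ *
      (r ^ 2)⁻¹ * ∫ y in ball x r, h y ^ 2 := by
  rw [setAverage_eq, measureReal_def, Measure.addHaar_ball_center volume x, ← measureReal_def,
    smul_eq_mul, mul_assoc, ← integral_const_mul (r ^ 2)⁻¹]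
  congr 1
  refine integral_congr_ae (Filter.Eventually.of_forall fun y => ?_)
  simp only [div_pow]
  ring

theorem nu1_sq_le {d : ℕ} {f : EuclideanSpace ℝ (Fin d) → ℝ} (hf : Measurable f)
    (hfi : ∀ x s, IntegrableOn f (ball x s)) (x : EuclideanSpace ℝ (Fin d)) {r : ℝ} (hr : 0 < r) :
    ENNReal.ofReal (volume.real (ball (0 : EuclideanSpace ℝ (Fin d)) r) ^ 2 * r ^ 2) *
        ENNReal.ofReal (nu1 d f x r ^ 2)
      ≤ ENNReal.ofReal (2 + 128 * d ^ 2 * 2 ^ d) *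
        ∫⁻ u in ball x (2 * r), ∫⁻ y in closedBall 0 (2 * r), secondDiffSq f u y := by
  obtain ⟨p, c, hpc⟩ := exists_affine_lintegral_sq_le hf hfi x hr
  refine le_trans ?_ hpc
  set v := volume.real (ball (0 : EuclideanSpace ℝ (Fin d)) r) with hv
  have hvpos : 0 < v := ENNReal.toReal_pos (measure_ball_pos _ _ hr).ne' measure_ball_lt_top.ne
  have hV : volume (ball (0 : EuclideanSpace ℝ (Fin d)) r) = ENNReal.ofReal v :=
    (ENNReal.ofReal_toReal measure_ball_lt_top.ne).symm
  have hn0 : 0 ≤ nu1 d f x r := Real.iInf_nonneg fun _ => Real.sqrt_nonneg _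
  have hn : nu1 d f x r ≤ √(⨍ y in ball x r, ((f y - (⟪p, y⟫ + c)) / r) ^ 2) :=
    ciInf_le ⟨0, by rintro _ ⟨q, rfl⟩; exact Real.sqrt_nonneg _⟩ (p, c)
  have havg := setAverage_ball_div_sq (fun y : EuclideanSpace ℝ (Fin d) => f y - (⟪p, y⟫ + c)) x r
  rw [← hv] at havg
  have hI : 0 ≤ ∫ y in ball x r, (f y - (⟪p, y⟫ + c)) ^ 2 := integral_nonneg fun _ => sq_nonneg _
  have h2 : nu1 d f x r ^ 2 ≤ v⁻¹ * (r ^ 2)⁻¹ * ∫ y in ball x r, (f y - (⟪p, y⟫ + c)) ^ 2 := by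
    rw [havg] at hn
    calc _ ≤ _ := pow_le_pow_left₀ hn0 hn 2
      _ = _ := Real.sq_sqrt (by positivity)
  calc _ ≤ ENNReal.ofReal (v ^ 2 * r ^ 2) * ENNReal.ofReal
        (v⁻¹ * (r ^ 2)⁻¹ * ∫ y in ball x r, (f y - (⟪p, y⟫ + c)) ^ 2) := by gcongr
    _ = ENNReal.ofReal v * ENNReal.ofReal (∫ y in ball x r, (f y - (⟪p, y⟫ + c)) ^ 2) := by
      rw [← ENNReal.ofReal_mul (by positivity), ← ENNReal.ofReal_mul (by positivity)]
      congr 1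
      field_simp
    _ ≤ _ := by
      rw [hV]
      refine mul_le_mul_right ?_ _
      rw [integral_eq_lintegral_of_nonneg_ae (Filter.Eventually.of_forall fun _ => sq_nonneg _)
        (by fun_prop)]
      exact ENNReal.ofReal_toReal_le

theorem lintegral_secondDiffSq_le {d : ℕ} {f : EuclideanSpace ℝ (Fin d) → ℝ} (hf : Measurable f)
    (p : EuclideanSpace ℝ (Fin d)) (c : ℝ) (w : EuclideanSpace ℝ (Fin d)) {r : ℝ} (hr : 0 < r) :
    ∫⁻ x in ball w (r / 2), ∫⁻ y in closedBall 0 (r / 2), secondDiffSq f x y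
      ≤ 36 * volume (ball (0 : EuclideanSpace ℝ (Fin d)) r) *
        ∫⁻ y in ball w r, ENNReal.ofReal ((f y - (⟪p, y⟫ + c)) ^ 2) := by
  set G : EuclideanSpace ℝ (Fin d) → ENNReal :=
    fun y => ENNReal.ofReal ((f y - (⟪p, y⟫ + c)) ^ 2) with hG
  have hGm : Measurable G := by fun_prop
  have hpt : ∀ x y, secondDiffSq f x y ≤ 12 * (G x + (G (x + y) + G (x - y))) := by
    intro x y
    simp only [secondDiffSq, hG, sq_abs]
    have twelve : (12 : ENNReal) = ENNReal.ofReal 12 := (ENNReal.ofReal_ofNat 12).symm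
    rw [← ENNReal.ofReal_add (by positivity) (by positivity),
      ← ENNReal.ofReal_add (by positivity) (by positivity), twelve,
      ← ENNReal.ofReal_mul (by positivity)]
    apply ENNReal.ofReal_le_ofReal
    rw [inner_add_right, inner_sub_right]
    set a := f x - (⟪p, x⟫ + c)
    set b := f (x + y) - (⟪p, x⟫ + ⟪p, y⟫ + c) with hb
    set e := f (x - y) - (⟪p, x⟫ - ⟪p, y⟫ + c)
    have : 2 * f x - f (x + y) - f (x - y) = 2 * a - b - e := by ring
    rw [this]
    nlinarith [sq_nonneg (2 * a + b), sq_nonneg (2 * a + e), sq_nonneg (b - e), sq_nonneg b,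
      sq_nonneg e, sq_nonneg a]
  set I := ∫⁻ y in ball w r, G y with hI
  have hvol : ∀ a : EuclideanSpace ℝ (Fin d), volume (ball a (r / 2)) ≤
      volume (ball (0 : EuclideanSpace ℝ (Fin d)) r) := fun a => by
    rw [Measure.addHaar_ball_center]
    exact measure_mono (ball_subset_ball (by linarith))
  have hvolc : volume (closedBall (0 : EuclideanSpace ℝ (Fin d)) (r / 2)) ≤
      volume (ball (0 : EuclideanSpace ℝ (Fin d)) r) :=
    measure_mono (closedBall_subset_ball (by linarith))
  have hadd : ∀ x ∈ ball w (r / 2), ∫⁻ y in closedBall 0 (r / 2), G (x + y) ≤ I := by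
    intro x hx
    rw [hI, ← lintegral_indicator measurableSet_closedBall,
      ← lintegral_indicator measurableSet_ball,
      ← lintegral_add_left_eq_self ((ball w r).indicator G) x]
    refine lintegral_mono fun y => Set.indicator_apply_le' (fun hy => ?_) fun _ => zero_le
    refine (Set.indicator_of_mem ?_ G).ge
    rw [mem_ball, dist_eq_norm] at *
    rw [mem_closedBall_zero_iff] at hy
    calc _ = ‖(x - w) + y‖ := by congr 1; abel
      _ ≤ ‖x - w‖ + ‖y‖ := norm_add_le _ _
      _ < r := by linarith
  have hsub : ∀ x ∈ ball w (r / 2), ∫⁻ y in closedBall 0 (r / 2), G (x - y) ≤ I := by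
    intro x hx
    rw [hI, ← lintegral_indicator measurableSet_closedBall,
      ← lintegral_indicator measurableSet_ball,
      ← lintegral_sub_left_eq_self ((ball w r).indicator G) x]
    refine lintegral_mono fun y => Set.indicator_apply_le' (fun hy => ?_) fun _ => zero_le
    refine (Set.indicator_of_mem ?_ G).ge
    rw [mem_ball, dist_eq_norm] at *
    rw [mem_closedBall_zero_iff] at hy
    calc _ = ‖(x - w) - y‖ := by congr 1; abel
      _ ≤ ‖x - w‖ + ‖y‖ := norm_sub_le _ _
      _ < r := by linarith
  set V := volume (ball (0 : EuclideanSpace ℝ (Fin d)) r)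
  have hinner : ∀ x ∈ ball w (r / 2), ∫⁻ y in closedBall 0 (r / 2), secondDiffSq f x y
      ≤ 12 * (G x * V + (I + I)) := by
    intro x hx
    refine (lintegral_mono (hpt x)).trans ?_
    rw [lintegral_const_mul _ (by fun_prop), lintegral_add_left (by fun_prop),
      lintegral_add_left (by fun_prop), setLIntegral_const]
    gcongr
    · exact hadd x hx
    · exact hsub x hx
  refine (setLIntegral_mono' measurableSet_ball hinner).trans ?_
  rw [lintegral_const_mul _ (by fun_prop), lintegral_add_left (by fun_prop),
    lintegral_mul_const _ hGm, setLIntegral_const]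
  calc _ ≤ 12 * (I * V + (I + I) * V) := by
        gcongr
        · exact lintegral_mono_set (ball_subset_ball (by linarith))
        · exact hvol w
    _ = _ := by ring

theorem lintegral_secondDiffSq_le_nu1 {d : ℕ} {f : EuclideanSpace ℝ (Fin d) → ℝ}
    (hf : Measurable f) (hf2 : LocallyIntegrable (fun x => f x ^ 2))
    (w : EuclideanSpace ℝ (Fin d)) {r : ℝ} (hr : 0 < r) :
    ∫⁻ x in ball w (r / 2), ∫⁻ y in closedBall 0 (r / 2), secondDiffSq f x y
      ≤ ENNReal.ofReal (36 * volume.real (ball (0 : EuclideanSpace ℝ (Fin d)) r) ^ 2 * r ^ 2) *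
        ENNReal.ofReal (nu1 d f w r ^ 2) := by
  set v := volume.real (ball (0 : EuclideanSpace ℝ (Fin d)) r) with hv
  have hvpos : 0 < v := ENNReal.toReal_pos (measure_ball_pos _ _ hr).ne' measure_ball_lt_top.ne
  have hV : volume (ball (0 : EuclideanSpace ℝ (Fin d)) r) = ENNReal.ofReal v :=
    (ENNReal.ofReal_toReal measure_ball_lt_top.ne).symm
  set X := ∫⁻ x in ball w (r / 2), ∫⁻ y in closedBall 0 (r / 2), secondDiffSq f x y
  have hfi := integrableOn_ball_of_sq hf hf2
  have hX : ∀ q : EuclideanSpace ℝ (Fin d) × ℝ, X ≤ ENNReal.ofReal (36 * v ^ 2 * r ^ 2 *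
      ⨍ y in ball w r, ((f y - (⟪q.1, y⟫ + q.2)) / r) ^ 2) := by
    rintro ⟨p, c⟩
    have hi : IntegrableOn (fun y => (f y - (⟪p, y⟫ + c)) ^ 2) (ball w r) := by
      have hL : MemLp f 2 (volume.restrict (ball w r)) :=
        (memLp_two_iff_integrable_sq hf.aestronglyMeasurable).2
          ((hf2.integrableOn_isCompact (isCompact_closedBall w r)).mono_set ball_subset_closedBall)
      have hA : MemLp (fun y => ⟪p, y⟫ + c) 2 (volume.restrict (ball w r)) := by
        refine (memLp_two_iff_integrable_sq (by fun_prop)).2 ?_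
        exact ((by fun_prop : Continuous fun y => (⟪p, y⟫ + c) ^ 2).continuousOn.integrableOn_compact
          (isCompact_closedBall w r)).mono_set ball_subset_closedBall
      exact (memLp_two_iff_integrable_sq (by fun_prop)).1 (hL.sub hA)
    have havg := setAverage_ball_div_sq (fun y : EuclideanSpace ℝ (Fin d) => f y - (⟪p, y⟫ + c)) w r
    rw [← hv] at havg
    refine (lintegral_secondDiffSq_le hf p c w hr).trans (le_of_eq ?_)
    rw [← ofReal_integral_eq_lintegral_ofReal hi (Filter.Eventually.of_forall fun _ => sq_nonneg _),
      havg, hV]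
    have n36 : (36 : ENNReal) = ENNReal.ofReal 36 := (ENNReal.ofReal_ofNat 36).symm
    rw [n36, ← ENNReal.ofReal_mul (by norm_num), ← ENNReal.ofReal_mul (by positivity)]
    congr 1
    field_simp
  have hXt : X ≠ ⊤ := ne_top_of_le_ne_top ENNReal.ofReal_ne_top (hX 0)
  set A := 36 * v ^ 2 * r ^ 2 with hA
  have hA0 : 0 < A := by positivity
  have hq0 : ∀ q : EuclideanSpace ℝ (Fin d) × ℝ,
      0 ≤ ⨍ y in ball w r, ((f y - (⟪q.1, y⟫ + q.2)) / r) ^ 2 := fun q =>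
    integral_nonneg fun _ => sq_nonneg _
  have hle : √(X.toReal / A) ≤ nu1 d f w r := by
    refine le_ciInf fun q => Real.sqrt_le_sqrt ?_
    rw [div_le_iff₀' hA0]
    exact ENNReal.toReal_le_of_le_ofReal (mul_nonneg hA0.le (hq0 q)) (hX q)
  rw [← ENNReal.ofReal_mul hA0.le, ← ENNReal.ofReal_toReal hXt]
  apply ENNReal.ofReal_le_ofReal
  have := pow_le_pow_left₀ (Real.sqrt_nonneg _) hle 2
  rw [Real.sq_sqrt (by positivity), div_le_iff₀' hA0] at this
  exact this

section Tonelli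

variable {E : Type*} [NormedAddCommGroup E] [MeasurableSpace E] [BorelSpace E]
  (μ : Measure E) [SFinite μ]

theorem lintegral_lintegral_ball [SecondCountableTopology E] {H : E → ENNReal}
    (hH : Measurable H) (A : Set E) (s : ℝ) :
    ∫⁻ x in A, ∫⁻ u in ball x s, H u ∂μ ∂μ = ∫⁻ u, H u * μ (ball u s ∩ A) ∂μ := by
  have hS : MeasurableSet {z : E × E | dist z.1 z.2 < s} :=
    measurableSet_lt (by fun_prop) measurable_const
  have hm : Measurable fun z : E × E => {z : E × E | dist z.1 z.2 < s}.indicator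
      (fun z => H z.2) z := (hH.comp measurable_snd).indicator hS
  have e1 : ∀ x, ∫⁻ u in ball x s, H u ∂μ
      = ∫⁻ u, {z : E × E | dist z.1 z.2 < s}.indicator (fun z => H z.2) (x, u) ∂μ := by
    intro x
    rw [← lintegral_indicator measurableSet_ball]
    congr 1 with u
    by_cases h : dist x u < s
    · rw [Set.indicator_of_mem (mem_ball'.2 h)]
      simp [h]
    · rw [Set.indicator_of_notMem (mt mem_ball'.1 h)]
      simp [h]
  simp only [e1]
  rw [lintegral_lintegral_swap hm.aemeasurable]
  congr 1 with u
  have e2 : ∀ x, {z : E × E | dist z.1 z.2 < s}.indicator (fun z => H z.2) (x, u)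
      = (ball u s).indicator (fun _ => H u) x := fun x => by
    by_cases h : dist x u < s
    · rw [Set.indicator_of_mem (mem_ball.2 h)]
      simp [h]
    · rw [Set.indicator_of_notMem (mt mem_ball.1 h)]
      simp [h]
  simp only [e2]
  rw [lintegral_indicator measurableSet_ball, setLIntegral_const,
    Measure.restrict_apply measurableSet_ball]

theorem lintegral_lintegral_ball_le [SecondCountableTopology E] [μ.IsAddHaarMeasure]
    {H : E → ENNReal} (hH : Measurable H) (z : E) (R s : ℝ) :
    ∫⁻ x in ball z R, ∫⁻ u in ball x s, H u ∂μ ∂μ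
      ≤ μ (ball 0 s) * ∫⁻ u in ball z (R + s), H u ∂μ := by
  rw [lintegral_lintegral_ball μ hH, ← lintegral_indicator measurableSet_ball,
    ← lintegral_const_mul _ (hH.indicator measurableSet_ball)]
  refine lintegral_mono fun u => ?_
  by_cases hu : u ∈ ball z (R + s)
  · rw [Set.indicator_of_mem hu, mul_comm, ← Measure.addHaar_ball_center μ u s]
    gcongr
    exact Set.inter_subset_left
  · have : ball u s ∩ ball z R = ∅ := by
      rw [Set.eq_empty_iff_forall_notMem]
      rintro x ⟨h1, h2⟩
      rw [mem_ball] at *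
      exact hu (by linarith [dist_triangle_left u z x])
    simp [this]

theorem mul_lintegral_ball_le [SecondCountableTopology E] [μ.IsAddHaarMeasure]
    {H : E → ENNReal} (hH : Measurable H) (z : E) (R s : ℝ) :
    μ (ball 0 s) * ∫⁻ x in ball z R, H x ∂μ
      ≤ ∫⁻ w in ball z (R + s), ∫⁻ x in ball w s, H x ∂μ ∂μ := by
  rw [lintegral_lintegral_ball μ hH, ← lintegral_indicator measurableSet_ball,
    ← lintegral_const_mul _ (hH.indicator measurableSet_ball)]
  refine lintegral_mono fun u => ?_
  by_cases hu : u ∈ ball z R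
  · rw [Set.indicator_of_mem hu, mul_comm, ← Measure.addHaar_ball_center μ u s]
    gcongr
    refine Set.subset_inter subset_rfl fun x hx => ?_
    rw [mem_ball] at *
    linarith [dist_triangle x u z]
  · simp [hu]

theorem lintegral_mul_lintegral_radius {F : E → E → ENNReal}
    (hF : Measurable fun z : E × E => F z.1 z.2) {w : ℝ → ENNReal} (hw : Measurable w)
    (A : Set E) (I : Set ℝ) (κ : ℝ) :
    ∫⁻ x in A, ∫⁻ y, F x y * (∫⁻ r in I, if ‖y‖ ≤ κ * r then w r else 0) ∂μ ∂μ
      = ∫⁻ r in I, w r * ∫⁻ x in A, ∫⁻ y in closedBall 0 (κ * r), F x y ∂μ ∂μ := by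
  have hW : Measurable fun q : E × ℝ => if ‖q.1‖ ≤ κ * q.2 then w q.2 else 0 :=
    Measurable.ite (measurableSet_le (by fun_prop) (by fun_prop)) (by fun_prop) measurable_const
  have hFy : ∀ x, Measurable (F x) := fun x => hF.comp measurable_prodMk_left
  have hFW : ∀ x, Measurable fun q : E × ℝ => F x q.1 * if ‖q.1‖ ≤ κ * q.2 then w q.2 else 0 :=
    fun x => ((hFy x).comp measurable_fst).mul hW
  have hFW3 : Measurable fun q : (E × ℝ) × E =>
      F q.1.1 q.2 * if ‖q.2‖ ≤ κ * q.1.2 then w q.1.2 else 0 :=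
    (hF.comp (by fun_prop : Measurable fun q : (E × ℝ) × E => (q.1.1, q.2))).mul
      (hW.comp (by fun_prop : Measurable fun q : (E × ℝ) × E => (q.2, q.1.2)))
  have e1 : ∀ x, ∫⁻ y, F x y * (∫⁻ r in I, if ‖y‖ ≤ κ * r then w r else 0) ∂μ
      = ∫⁻ r in I, ∫⁻ y, F x y * (if ‖y‖ ≤ κ * r then w r else 0) ∂μ := fun x => by
    rw [lintegral_lintegral_swap (f := fun r y => F x y * if ‖y‖ ≤ κ * r then w r else 0)
      ((hFW x).comp measurable_swap).aemeasurable]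
    congr 1 with y
    have hWy : Measurable fun r => if ‖y‖ ≤ κ * r then w r else 0 :=
      hW.comp measurable_prodMk_left
    rw [lintegral_const_mul _ hWy]
  simp only [e1]
  rw [lintegral_lintegral_swap hFW3.lintegral_prod_right'.aemeasurable]
  congr 1 with r
  have e2 : ∀ x, ∫⁻ y, F x y * (if ‖y‖ ≤ κ * r then w r else 0) ∂μ
      = w r * ∫⁻ y in closedBall 0 (κ * r), F x y ∂μ := fun x => by
    rw [← lintegral_const_mul _ (hFy x), ← lintegral_indicator measurableSet_closedBall]
    congr 1 with y
    by_cases h : ‖y‖ ≤ κ * r <;> simp [h, mul_comm]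
  simp only [e2]
  rw [lintegral_const_mul]
  exact hF.lintegral_prod_right'

end Tonelli

theorem ofReal_rpow_le_lintegral {ρ R β : ℝ} (hρ : 0 < ρ) (hR : ρ ≤ R) (hβ : 0 < β) :
    ENNReal.ofReal (ρ ^ (-β)) ≤ ENNReal.ofReal (4 ^ (β + 1) / 2) *
      ∫⁻ r in Set.Ioo 0 (4 * R), if ρ ≤ 1 / 2 * r then ENNReal.ofReal (r ^ (-β - 1)) else 0 := by
  have h1 : ENNReal.ofReal ((4 * ρ) ^ (-β - 1)) * ENNReal.ofReal (2 * ρ)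
      ≤ ∫⁻ r in Set.Ioo 0 (4 * R),
        if ρ ≤ 1 / 2 * r then ENNReal.ofReal (r ^ (-β - 1)) else 0 := by
    calc _ = ∫⁻ r in Set.Ioo (2 * ρ) (4 * ρ), ENNReal.ofReal ((4 * ρ) ^ (-β - 1)) := by
          rw [setLIntegral_const, Real.volume_Ioo]
          congr 2
          ring
      _ ≤ ∫⁻ r in Set.Ioo (2 * ρ) (4 * ρ),
          if ρ ≤ 1 / 2 * r then ENNReal.ofReal (r ^ (-β - 1)) else 0 := by
          refine setLIntegral_mono' measurableSet_Ioo fun r hr => ?_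
          rw [if_pos (by linarith [hr.1])]
          exact ENNReal.ofReal_le_ofReal
            (Real.rpow_le_rpow_of_nonpos (by linarith [hr.1]) hr.2.le (by linarith))
      _ ≤ _ := lintegral_mono_set (Set.Ioo_subset_Ioo (by linarith) (by linarith))
  refine le_trans (le_of_eq ?_) (mul_le_mul_right h1 _)
  rw [← ENNReal.ofReal_mul (by positivity), ← ENNReal.ofReal_mul (by positivity)]
  congr 1
  rw [show -β - 1 = -(β + 1) by ring, Real.mul_rpow (by norm_num) hρ.le,
    Real.rpow_neg (by norm_num : (0 : ℝ) ≤ 4), Real.rpow_neg hρ.le, Real.rpow_neg hρ.le,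
    Real.rpow_add hρ, Real.rpow_one]
  have : (0 : ℝ) < 4 ^ (β + 1) := by positivity
  have : 0 < ρ ^ β := by positivity
  field_simp

theorem lintegral_le_ofReal_rpow {ρ β : ℝ} (R : ℝ) (hρ : 0 < ρ) (hβ : 0 < β) :
    ∫⁻ r in Set.Ioo 0 R, (if ρ ≤ 2 * r then ENNReal.ofReal (r ^ (-β - 1)) else 0)
      ≤ ENNReal.ofReal (2 ^ β / β) * ENNReal.ofReal (ρ ^ (-β)) := by
  have h0 : 0 < ρ / 2 := by positivity
  calc _ ≤ ∫⁻ r, (if ρ ≤ 2 * r then ENNReal.ofReal (r ^ (-β - 1)) else 0) :=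
        setLIntegral_le_lintegral _ _
    _ = ∫⁻ r in Set.Ici (ρ / 2), ENNReal.ofReal (r ^ (-β - 1)) := by
        rw [← lintegral_indicator measurableSet_Ici]
        congr 1 with r
        simp only [Set.indicator_apply, Set.mem_Ici, div_le_iff₀' (zero_lt_two' ℝ)]
    _ = ∫⁻ r in Set.Ioi (ρ / 2), ENNReal.ofReal (r ^ (-β - 1)) :=
        setLIntegral_congr Ioi_ae_eq_Ici.symm
    _ = ENNReal.ofReal (∫ r in Set.Ioi (ρ / 2), r ^ (-β - 1)) := by
        rw [ofReal_integral_eq_lintegral_ofReal (integrableOn_Ioi_rpow_of_lt (by linarith) h0)]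
        filter_upwards [ae_restrict_mem measurableSet_Ioi] with r hr
        exact Real.rpow_nonneg (h0.trans hr).le _
    _ = _ := by
        rw [integral_Ioi_rpow_of_lt (by linarith) h0, ← ENNReal.ofReal_mul (by positivity)]
        congr 1
        rw [sub_add_cancel, Real.div_rpow hρ.le (by norm_num), Real.rpow_neg zero_le_two,
          Real.rpow_neg hρ.le]
        field_simp

theorem rpow_neg_dim_sub_one {r : ℝ} (hr : 0 < r) (d : ℕ) (α : ℝ) :
    r ^ (-((d : ℝ) + 2 * α) - 1) = ((r ^ (α - 1)) ^ 2 * r ^ d * r ^ 3)⁻¹ := by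
  rw [← Real.rpow_natCast (r ^ (α - 1)), ← Real.rpow_mul hr.le, ← Real.rpow_natCast r d,
    ← Real.rpow_natCast r 3, ← Real.rpow_add hr, ← Real.rpow_add hr, ← Real.rpow_neg hr.le]
  congr 1
  push_cast
  ring

theorem volume_real_ball_zero {d : ℕ} {r : ℝ} (hr : 0 < r) :
    volume.real (ball (0 : EuclideanSpace ℝ (Fin d)) r)
      = volume.real (ball (0 : EuclideanSpace ℝ (Fin d)) 1) * r ^ d := by
  rw [measureReal_def, Measure.addHaar_ball_of_pos _ _ hr, ENNReal.toReal_mul,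
    ENNReal.toReal_ofReal (by positivity), finrank_euclideanSpace_fin, mul_comm, measureReal_def]

theorem lintegral_nu1_div {d : ℕ} (f : EuclideanSpace ℝ (Fin d) → ℝ) (α : ℝ) {r : ℝ} (hr : 0 < r)
    (A : Set (EuclideanSpace ℝ (Fin d))) :
    (∫⁻ x in A, ENNReal.ofReal ((nu1 d f x r / r ^ (α - 1)) ^ 2)) / ENNReal.ofReal r
      = ENNReal.ofReal (((r ^ (α - 1)) ^ 2 * r)⁻¹) * ∫⁻ x in A, ENNReal.ofReal (nu1 d f x r ^ 2) := by
  have hs : 0 < r ^ (α - 1) := by positivity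
  have e : ∀ x, ENNReal.ofReal ((nu1 d f x r / r ^ (α - 1)) ^ 2)
      = ENNReal.ofReal (((r ^ (α - 1)) ^ 2)⁻¹) * ENNReal.ofReal (nu1 d f x r ^ 2) := fun x => by
    rw [← ENNReal.ofReal_mul (by positivity), div_pow, div_eq_inv_mul]
  simp only [e]
  rw [lintegral_const_mul' _ _ ENNReal.ofReal_ne_top, div_eq_mul_inv,
    ← ENNReal.ofReal_inv_of_pos hr, mul_inv, ENNReal.ofReal_mul (by positivity)]
  ring

theorem ofReal_div_rpow_eq {d : ℕ} (f : EuclideanSpace ℝ (Fin d) → ℝ) (β : ℝ)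
    (x y : EuclideanSpace ℝ (Fin d)) :
    ENNReal.ofReal (|2 * f x - f (x + y) - f (x - y)| ^ 2 / ‖y‖ ^ β)
      = secondDiffSq f x y * ENNReal.ofReal (‖y‖ ^ (-β)) := by
  rw [secondDiffSq, ← ENNReal.ofReal_mul (by positivity), Real.rpow_neg (norm_nonneg y),
    div_eq_mul_inv]

theorem secondDiffSq_zero_right {E : Type*} [AddCommGroup E] (f : E → ℝ) (u : E) :
    secondDiffSq f u 0 = 0 := by
  simp [secondDiffSq, two_mul]

theorem ofReal_volume_real_ball {d : ℕ} (x : EuclideanSpace ℝ (Fin d)) (r : ℝ) :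
    ENNReal.ofReal (volume.real (ball x r)) = volume (ball x r) :=
  ofReal_measureReal measure_ball_lt_top.ne

theorem volume_real_ball_pos {d : ℕ} (x : EuclideanSpace ℝ (Fin d)) {r : ℝ} (hr : 0 < r) :
    0 < volume.real (ball x r) :=
  ENNReal.toReal_pos (measure_ball_pos _ _ hr).ne' measure_ball_lt_top.ne

theorem lintegral_nu1_div_le {d : ℕ} {f : EuclideanSpace ℝ (Fin d) → ℝ} (hf : Measurable f)
    (hf2 : LocallyIntegrable (fun x => f x ^ 2)) (α : ℝ) (z : EuclideanSpace ℝ (Fin d)) {r R : ℝ}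
    (hr : 0 < r) (hrR : r < R) :
    (∫⁻ x in ball z R, ENNReal.ofReal ((nu1 d f x r / r ^ (α - 1)) ^ 2)) / ENNReal.ofReal r
      ≤ ENNReal.ofReal (2 ^ d * (2 + 128 * d ^ 2 * 2 ^ d)
            / volume.real (ball (0 : EuclideanSpace ℝ (Fin d)) 1)) *
          (ENNReal.ofReal (r ^ (-((d : ℝ) + 2 * α) - 1)) *
            ∫⁻ u in ball z (3 * R), ∫⁻ y in closedBall 0 (2 * r), secondDiffSq f u y) := by
  set v := volume.real (ball (0 : EuclideanSpace ℝ (Fin d)) r) with hv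
  set κ := volume.real (ball (0 : EuclideanSpace ℝ (Fin d)) 1) with hκ
  have hvpos : 0 < v := volume_real_ball_pos _ hr
  have hκpos : 0 < κ := volume_real_ball_pos _ one_pos
  have hs : 0 < r ^ (α - 1) := by positivity
  have hH : Measurable fun u => ∫⁻ y in closedBall 0 (2 * r), secondDiffSq f u y :=
    (measurable_secondDiffSq hf).lintegral_prod_right'
  have hpt : ∀ x, ENNReal.ofReal (nu1 d f x r ^ 2)
      ≤ ENNReal.ofReal ((v ^ 2 * r ^ 2)⁻¹ * (2 + 128 * d ^ 2 * 2 ^ d)) *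
        ∫⁻ u in ball x (2 * r), ∫⁻ y in closedBall 0 (2 * r), secondDiffSq f u y := fun x => by
    have h := mul_le_mul_right (nu1_sq_le hf (integrableOn_ball_of_sq hf hf2) x hr)
      (ENNReal.ofReal ((v ^ 2 * r ^ 2)⁻¹))
    rw [← mul_assoc, ← mul_assoc, ← ENNReal.ofReal_mul (by positivity),
      inv_mul_cancel₀ (by positivity), ENNReal.ofReal_one, one_mul,
      ← ENNReal.ofReal_mul (by positivity)] at h
    exact h
  rw [lintegral_nu1_div f α hr]
  calc _ ≤ ENNReal.ofReal (((r ^ (α - 1)) ^ 2 * r)⁻¹) *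
        (ENNReal.ofReal ((v ^ 2 * r ^ 2)⁻¹ * (2 + 128 * d ^ 2 * 2 ^ d)) *
        ∫⁻ x in ball z R, ∫⁻ u in ball x (2 * r),
          ∫⁻ y in closedBall 0 (2 * r), secondDiffSq f u y) := by
        rw [← lintegral_const_mul' (ENNReal.ofReal ((v ^ 2 * r ^ 2)⁻¹ * _)) _
          ENNReal.ofReal_ne_top]
        exact mul_le_mul_right (lintegral_mono fun x => hpt x) _
    _ ≤ ENNReal.ofReal (((r ^ (α - 1)) ^ 2 * r)⁻¹) *
        (ENNReal.ofReal ((v ^ 2 * r ^ 2)⁻¹ * (2 + 128 * d ^ 2 * 2 ^ d)) *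
        (ENNReal.ofReal (κ * (2 * r) ^ d) * ∫⁻ u in ball z (3 * R),
          ∫⁻ y in closedBall 0 (2 * r), secondDiffSq f u y)) := by
        rw [hκ, ← volume_real_ball_zero (by positivity), ofReal_volume_real_ball]
        gcongr _ * (_ * ?_)
        refine (lintegral_lintegral_ball_le volume hH z R (2 * r)).trans ?_
        gcongr
        linarith
    _ = _ := by
        simp only [← mul_assoc]
        rw [← ENNReal.ofReal_mul (by positivity), ← ENNReal.ofReal_mul (by positivity),
          ← ENNReal.ofReal_mul (by positivity)]
        congr 2
        rw [rpow_neg_dim_sub_one hr, hv, volume_real_ball_zero hr, ← hκ, mul_pow 2 r]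
        field_simp

theorem lintegral_secondDiffSq_le_lintegral_nu1_div {d : ℕ} {f : EuclideanSpace ℝ (Fin d) → ℝ}
    (hf : Measurable f) (hf2 : LocallyIntegrable (fun x => f x ^ 2)) (α : ℝ)
    (z : EuclideanSpace ℝ (Fin d)) {r R : ℝ} (hr : 0 < r) (hrR : r < 4 * R) :
    ENNReal.ofReal (r ^ (-((d : ℝ) + 2 * α) - 1)) *
        ∫⁻ x in ball z R, ∫⁻ y in closedBall 0 (1 / 2 * r), secondDiffSq f x y
      ≤ ENNReal.ofReal (36 * 2 ^ d * volume.real (ball (0 : EuclideanSpace ℝ (Fin d)) 1)) *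
        ((∫⁻ x in ball z (4 * R), ENNReal.ofReal ((nu1 d f x r / r ^ (α - 1)) ^ 2)) /
          ENNReal.ofReal r) := by
  set κ := volume.real (ball (0 : EuclideanSpace ℝ (Fin d)) 1) with hκ
  have hκpos : 0 < κ := volume_real_ball_pos _ one_pos
  have hs : 0 < r ^ (α - 1) := by positivity
  have hH : Measurable fun u => ∫⁻ y in closedBall 0 (r / 2), secondDiffSq f u y :=
    (measurable_secondDiffSq hf).lintegral_prod_right'
  have h1 : ENNReal.ofReal (κ * (r / 2) ^ d) *
      ∫⁻ x in ball z R, ∫⁻ y in closedBall 0 (r / 2), secondDiffSq f x y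
      ≤ ENNReal.ofReal (36 * (κ * r ^ d) ^ 2 * r ^ 2) *
        ∫⁻ x in ball z (4 * R), ENNReal.ofReal (nu1 d f x r ^ 2) := by
    rw [hκ, ← volume_real_ball_zero (by positivity), ← volume_real_ball_zero hr,
      ofReal_volume_real_ball, ← lintegral_const_mul' _ _ ENNReal.ofReal_ne_top]
    refine (mul_lintegral_ball_le volume hH z R (r / 2)).trans ?_
    refine (lintegral_mono_set (ball_subset_ball (by linarith))).trans
      (lintegral_mono fun w => ?_)
    exact lintegral_secondDiffSq_le_nu1 hf hf2 w hr
  have h2 := mul_le_mul_right h1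
    (ENNReal.ofReal (r ^ (-((d : ℝ) + 2 * α) - 1) * (κ * (r / 2) ^ d)⁻¹))
  rw [← mul_assoc, ← mul_assoc, ← ENNReal.ofReal_mul (by positivity),
    ← ENNReal.ofReal_mul (by positivity), inv_mul_cancel_right₀ (by positivity)] at h2
  rw [lintegral_nu1_div f α hr, ← mul_assoc, ← ENNReal.ofReal_mul (by positivity),
    show 1 / 2 * r = r / 2 by ring]
  refine h2.trans_eq ?_
  congr 2
  rw [rpow_neg_dim_sub_one hr, div_pow]
  field_simp

theorem lintegral_nu1_le_lintegral_secondDiff {d : ℕ} {f : EuclideanSpace ℝ (Fin d) → ℝ}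
    (hf : Measurable f) (hf2 : LocallyIntegrable (fun x => f x ^ 2)) {α : ℝ} (hα : 0 < α)
    (z : EuclideanSpace ℝ (Fin d)) (R : ℝ) :
    (∫⁻ r in Set.Ioo (0 : ℝ) R, (∫⁻ x in ball z R,
        ENNReal.ofReal ((nu1 d f x r / r ^ (α - 1)) ^ 2)) / ENNReal.ofReal r)
      ≤ ENNReal.ofReal (2 ^ d * (2 + 128 * d ^ 2 * 2 ^ d)
            / volume.real (ball (0 : EuclideanSpace ℝ (Fin d)) 1)) *
          (ENNReal.ofReal (2 ^ ((d : ℝ) + 2 * α) / (d + 2 * α)) *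
            ∫⁻ x in ball z (3 * R), ∫⁻ y in closedBall (0 : EuclideanSpace ℝ (Fin d)) (3 * R),
              ENNReal.ofReal
                (|2 * f x - f (x + y) - f (x - y)| ^ 2 / ‖y‖ ^ ((d : ℝ) + 2 * α))) := by
  have hβ : 0 < (d : ℝ) + 2 * α := by positivity
  have hw : Measurable fun r : ℝ => ENNReal.ofReal (r ^ (-((d : ℝ) + 2 * α) - 1)) := by fun_prop
  refine (setLIntegral_mono' measurableSet_Ioo fun r hr =>
    lintegral_nu1_div_le hf hf2 α z hr.1 hr.2).trans ?_
  rw [lintegral_const_mul' _ _ ENNReal.ofReal_ne_top, ← lintegral_mul_lintegral_radius volume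
    (measurable_secondDiffSq hf) hw]
  refine mul_le_mul_right ?_ _
  rw [← lintegral_const_mul' _ _ ENNReal.ofReal_ne_top]
  refine lintegral_mono fun x => ?_
  dsimp only
  rw [← lintegral_const_mul' _ _ ENNReal.ofReal_ne_top,
    ← lintegral_indicator measurableSet_closedBall]
  refine lintegral_mono fun y => ?_
  dsimp only
  by_cases hy : y ∈ closedBall 0 (3 * R)
  · rw [Set.indicator_of_mem hy, ofReal_div_rpow_eq]
    rcases eq_or_ne y 0 with rfl | hy0
    · simp [secondDiffSq_zero_right]
    · rw [mul_left_comm]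
      exact mul_le_mul_right (lintegral_le_ofReal_rpow R (norm_pos_iff.2 hy0) hβ) _
  · rw [Set.indicator_of_notMem hy, nonpos_iff_eq_zero]
    rw [mem_closedBall_zero_iff, not_le] at hy
    refine mul_eq_zero_of_right _ ?_
    refine le_antisymm ((setLIntegral_mono' measurableSet_Ioo (g := 0) fun r hr => ?_).trans_eq
      lintegral_zero) zero_le
    exact (if_neg (by linarith [hr.1, hr.2])).le

theorem lintegral_secondDiff_le_lintegral_nu1 {d : ℕ} {f : EuclideanSpace ℝ (Fin d) → ℝ}
    (hf : Measurable f) (hf2 : LocallyIntegrable (fun x => f x ^ 2)) {α : ℝ} (hα : 0 < α)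
    (z : EuclideanSpace ℝ (Fin d)) (R : ℝ) :
    (∫⁻ x in ball z R, ∫⁻ y in closedBall (0 : EuclideanSpace ℝ (Fin d)) R,
        ENNReal.ofReal (|2 * f x - f (x + y) - f (x - y)| ^ 2 / ‖y‖ ^ ((d : ℝ) + 2 * α)))
      ≤ ENNReal.ofReal (4 ^ ((d : ℝ) + 2 * α + 1) / 2) *
          (ENNReal.ofReal (36 * 2 ^ d * volume.real (ball (0 : EuclideanSpace ℝ (Fin d)) 1)) *
            ∫⁻ r in Set.Ioo (0 : ℝ) (4 * R), (∫⁻ x in ball z (4 * R),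
              ENNReal.ofReal ((nu1 d f x r / r ^ (α - 1)) ^ 2)) / ENNReal.ofReal r) := by
  have hβ : 0 < (d : ℝ) + 2 * α := by positivity
  have hw : Measurable fun r : ℝ => ENNReal.ofReal (r ^ (-((d : ℝ) + 2 * α) - 1)) := by fun_prop
  rw [← lintegral_const_mul' _ (fun r => _ / _) ENNReal.ofReal_ne_top]
  refine le_trans ?_ (mul_le_mul_right (setLIntegral_mono' measurableSet_Ioo fun r hr =>
    lintegral_secondDiffSq_le_lintegral_nu1_div hf hf2 α z hr.1 hr.2) _)
  rw [← lintegral_mul_lintegral_radius volume (measurable_secondDiffSq hf) hw,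
    ← lintegral_const_mul' _ _ ENNReal.ofReal_ne_top]
  refine lintegral_mono fun x => ?_
  dsimp only
  rw [← lintegral_const_mul' _ _ ENNReal.ofReal_ne_top]
  refine (setLIntegral_mono' measurableSet_closedBall fun y hy => ?_).trans
    (setLIntegral_le_lintegral (closedBall 0 R) _)
  rw [ofReal_div_rpow_eq]
  rcases eq_or_ne y 0 with rfl | hy0
  · simp [secondDiffSq_zero_right]
  · rw [mul_left_comm]
    exact mul_le_mul_right
      (ofReal_rpow_le_lintegral (norm_pos_iff.2 hy0) (mem_closedBall_zero_iff.1 hy) hβ) _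

/-- For `1 ≤ α < 2` and `f` locally square-integrable satisfying the tempered
growth condition, the Strichartz second-difference condition
`∫_{B_R(z)}∫_{|y|≤R} |2f(x)−f(x+y)−f(x−y)|²/|y|^{d+2α} ≤ B² R^d` and the square function
condition `∫_0^R ∫_{B_R(z)} (ν₁^f(x,r)/r^{α−1})² dx dr/r ≤ C R^d` are equivalent, with optimal
constants satisfying `B² ≈ C` up to factors depending only on `d` and `α`. -/
theorem strichartz_iff_nu1_square_function (d : ℕ) (hd : 0 < d)
    (α : ℝ) (hα0 : 1 ≤ α) (hα1 : α < 2) :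
    ∃ K : ℝ, 0 < K ∧
      ∀ f : EuclideanSpace ℝ (Fin d) → ℝ, Measurable f →
        LocallyIntegrable (fun x => (f x) ^ 2) volume →
        (∀ ε : ℝ, α < ε →
          Integrable (fun x => |f x| / (1 + ‖x‖ ^ ((d : ℝ) + ε)))) →
        ∀ B : ℝ, 0 ≤ B →
        (((∀ (z : EuclideanSpace ℝ (Fin d)) (R : ℝ), 0 < R →
            (∫⁻ x in ball z R, ∫⁻ y in closedBall (0 : EuclideanSpace ℝ (Fin d)) R,
              ENNReal.ofReal
                (|2 * f x - f (x + y) - f (x - y)| ^ 2 / ‖y‖ ^ ((d : ℝ) + 2 * α)))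
              ≤ ENNReal.ofReal (B ^ 2 * R ^ (d : ℕ))) →
          (∀ (z : EuclideanSpace ℝ (Fin d)) (R : ℝ), 0 < R →
            (∫⁻ r in Set.Ioo (0 : ℝ) R,
              (∫⁻ x in ball z R,
                ENNReal.ofReal ((nu1 d f x r / r ^ (α - 1)) ^ 2)) / ENNReal.ofReal r)
              ≤ ENNReal.ofReal (K * B ^ 2 * R ^ (d : ℕ)))) ∧
        ((∀ (z : EuclideanSpace ℝ (Fin d)) (R : ℝ), 0 < R →
            (∫⁻ r in Set.Ioo (0 : ℝ) R,
              (∫⁻ x in ball z R,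
                ENNReal.ofReal ((nu1 d f x r / r ^ (α - 1)) ^ 2)) / ENNReal.ofReal r)
              ≤ ENNReal.ofReal (B * R ^ (d : ℕ))) →
          (∀ (z : EuclideanSpace ℝ (Fin d)) (R : ℝ), 0 < R →
            (∫⁻ x in ball z R, ∫⁻ y in closedBall (0 : EuclideanSpace ℝ (Fin d)) R,
              ENNReal.ofReal
                (|2 * f x - f (x + y) - f (x - y)| ^ 2 / ‖y‖ ^ ((d : ℝ) + 2 * α)))
              ≤ ENNReal.ofReal (K * B * R ^ (d : ℕ))))) := by
  have hβ : 0 < (d : ℝ) + 2 * α := by positivity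
  set κ := volume.real (ball (0 : EuclideanSpace ℝ (Fin d)) 1) with hκ
  have hκpos : 0 < κ := volume_real_ball_pos _ one_pos
  set K₁ := 2 ^ d * (2 + 128 * d ^ 2 * 2 ^ d) / κ * (2 ^ ((d : ℝ) + 2 * α) / (d + 2 * α)) * 3 ^ d
    with hK₁
  set K₂ := 4 ^ ((d : ℝ) + 2 * α + 1) / 2 * (36 * 2 ^ d * κ) * 4 ^ d with hK₂
  have hK₁pos : 0 < K₁ := by positivity
  have hK₂pos : 0 < K₂ := by positivity
  refine ⟨K₁ + K₂, by positivity, fun f hf hf2 _ B hB => ⟨fun h z R hR => ?_, fun h z R hR => ?_⟩⟩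
  · calc _ ≤ _ := lintegral_nu1_le_lintegral_secondDiff hf hf2 (by linarith) z R
      _ ≤ _ := mul_le_mul_right (mul_le_mul_right (h z (3 * R) (by positivity)) _) _
      _ = ENNReal.ofReal (K₁ * B ^ 2 * R ^ d) := by
        rw [← ENNReal.ofReal_mul (by positivity), ← ENNReal.ofReal_mul (by positivity), mul_pow]
        congr 1
        ring
      _ ≤ _ := by
        gcongr
        linarith
  · calc _ ≤ _ := lintegral_secondDiff_le_lintegral_nu1 hf hf2 (by linarith) z R
      _ ≤ _ := mul_le_mul_right (mul_le_mul_right (h z (4 * R) (by positivity)) _) _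
      _ = ENNReal.ofReal (K₂ * B * R ^ d) := by
        rw [← ENNReal.ofReal_mul (by positivity), ← ENNReal.ofReal_mul (by positivity), mul_pow]
        congr 1
        ring
      _ ≤ _ := by
        gcongr
        linarith
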